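/- Let X ⊆ ℝ^d for some d, let T : X → X be a measurable map preserving a Borel probability measure ν, and assume (X,T,ν) has decay of correlations with respect to Lipschitz observables faster than any polynomial rate: for every p > 0 there is C_p > 0 such that for all Lipschitz f, g : X → ℝ and all n ≥ 1, | ∫ f·(g∘Tⁿ) dν − (∫ f dν)(∫ g dν) | ≤ C_p n^{−p} ‖f‖_{Lip} ‖g‖_{Lip}. Then for ν-almost every x ∈ X with d̲_ν(x) > 0, the return time satisfies limsup_{r→0} log τ_r(x) / (−log r) = d̄_ν(x) and liminf_{r→0} log τ_r(x) / (−log r) = d̲_ν(x). -/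

import Mathlib

open MeasureTheory Set Filter Metric
open scoped ENNReal Topology

noncomputable section

/-- The hitting time `τ_r(x,y) = min { n ≥ 1 : d(Tⁿx, y) < r }`, with value `⊤`
if the orbit of `x` never enters `B_r(y)`; the return time is `τ_r(x) = τ_r(x,x)`. -/
def hitTime {X : Type*} [PseudoMetricSpace X] (T : X → X) (x y : X) (r : ℝ) : ℕ∞ :=
  sInf ((fun m : ℕ => (m : ℕ∞)) '' {m : ℕ | 1 ≤ m ∧ dist (T^[m] x) y < r})

/-- The lower local dimension `d̲_ν(x) = liminf_{r→0} log ν(B_r(x)) / log r`. -/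
def dimLower {X : Type*} [PseudoMetricSpace X] [MeasurableSpace X]
    (ν : Measure X) (x : X) : ℝ :=
  Filter.liminf (fun r : ℝ => Real.log (ν (Metric.ball x r)).toReal / Real.log r) (𝓝[>] 0)

/-- The upper local dimension `d̄_ν(x) = limsup_{r→0} log ν(B_r(x)) / log r`. -/
def dimUpper {X : Type*} [PseudoMetricSpace X] [MeasurableSpace X]
    (ν : Measure X) (x : X) : ℝ :=
  Filter.limsup (fun r : ℝ => Real.log (ν (Metric.ball x r)).toReal / Real.log r) (𝓝[>] 0)

/-- index of the grid cube of side `s` containing `x` -/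
def gridKey {d : ℕ} (s : ℝ) (x : EuclideanSpace ℝ (Fin d)) : Fin d → ℤ := fun i => ⌊x i / s⌋

lemma gridKey_meas {d : ℕ} (s : ℝ) : Measurable (gridKey (d := d) s) := by
  unfold gridKey
  rw [measurable_pi_iff]
  intro i
  apply Measurable.floor
  fun_prop

lemma gridKey_near {d : ℕ} {s : ℝ} (hs : 0 < s) (m : ℕ) (x y : EuclideanSpace ℝ (Fin d))
    (h : dist x y < m * s) (i : Fin d) : |gridKey s x i - gridKey s y i| ≤ m := by
  have h1 : |x i - y i| ≤ dist x y := by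
    have := PiLp.norm_apply_le (x - y) i
    simpa [dist_eq_norm] using this
  have h2 : |x i / s - y i / s| < m := by
    rw [← sub_div, abs_div, abs_of_pos hs, div_lt_iff₀ hs]
    linarith
  unfold gridKey
  rw [abs_lt] at h2
  have a1 := Int.floor_le (x i / s)
  have a2 := Int.lt_floor_add_one (x i / s)
  have a3 := Int.floor_le (y i / s)
  have a4 := Int.lt_floor_add_one (y i / s)
  rw [abs_le]
  constructor
  · have : (-(m:ℤ) - 1 : ℝ) < ((⌊x i / s⌋ - ⌊y i / s⌋ : ℤ) : ℝ) := by push_cast; linarith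
    have : (-(m:ℤ) - 1) < (⌊x i / s⌋ - ⌊y i / s⌋ : ℤ) := by exact_mod_cast this
    linarith
  · have : ((⌊x i / s⌋ - ⌊y i / s⌋ : ℤ) : ℝ) < ((m:ℤ) + 1 : ℝ) := by push_cast; linarith
    have : (⌊x i / s⌋ - ⌊y i / s⌋ : ℤ) < (m:ℤ) + 1 := by exact_mod_cast this
    linarith

lemma gridKey_dist {d : ℕ} {s : ℝ} (hs : 0 < s) (x y : EuclideanSpace ℝ (Fin d))
    (h : gridKey s x = gridKey s y) : dist x y < (d + 1) * s := by
  have h1 : ∀ i, dist (x i) (y i) ≤ s := by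
    intro i
    have := congrFun h i
    unfold gridKey at this
    have := Int.abs_sub_lt_one_of_floor_eq_floor this
    rw [← sub_div, abs_div, abs_of_pos hs, div_lt_one hs] at this
    exact this.le
  have h2 : dist x y ≤ d * s := by
    rw [EuclideanSpace.dist_eq]
    apply Real.sqrt_le_iff.2
    refine ⟨by positivity, ?_⟩
    calc ∑ i, dist (x i) (y i) ^ 2 ≤ ∑ i : Fin d, s ^ 2 := by
          apply Finset.sum_le_sum
          intro i _
          exact pow_le_pow_left₀ dist_nonneg (h1 i) 2
      _ = d * s ^ 2 := by simp
      _ ≤ (d * s) ^ 2 := by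
          rw [mul_pow]
          apply mul_le_mul_of_nonneg_right _ (by positivity)
          have : d ≤ d ^ 2 := Nat.le_self_pow (by norm_num) d
          exact_mod_cast this
  linarith

lemma gridKey_count {d : ℕ} {s R : ℝ} (hs : 0 < s) (hs1 : s ≤ 1) (hR : 0 ≤ R) :
    ∃ F : Finset (Fin d → ℤ), (∀ x : EuclideanSpace ℝ (Fin d), dist x 0 < R → gridKey s x ∈ F) ∧
      (F.card : ℝ) ≤ ((2 * R + 3) / s) ^ d := by
  set m : ℕ := ⌈R / s⌉₊ with hm
  refine ⟨Fintype.piFinset fun _ => Finset.Icc (-(m : ℤ)) m, ?_, ?_⟩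
  · intro x hx
    rw [Fintype.mem_piFinset]
    intro i
    have := gridKey_near hs m x 0 (lt_of_lt_of_le hx (by
      rw [← div_le_iff₀ hs]; exact Nat.le_ceil _)) i
    rw [abs_le] at this
    simp [gridKey] at this ⊢
    exact this
  · rw [Fintype.card_piFinset]
    simp only [Finset.prod_const, Finset.card_univ, Fintype.card_fin, Int.card_Icc]
    push_cast
    apply pow_le_pow_left₀ (by positivity)
    have h1 : (((m:ℤ) + 1 - -(m:ℤ)).toNat : ℝ) = 2 * m + 1 := by
      have : ((m:ℤ) + 1 - -(m:ℤ)).toNat = 2 * m + 1 := by omega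
      rw [this]; push_cast; ring
    rw [h1, le_div_iff₀ hs]
    have h2 : (m : ℝ) < R / s + 1 := Nat.ceil_lt_add_one (by positivity)
    have h3 : (m : ℝ) * s < R + s := by
      have := mul_lt_mul_of_pos_right h2 hs
      rw [add_mul, div_mul_cancel₀ _ hs.ne'] at this
      linarith
    nlinarith

lemma gridKey_overlap {d : ℕ} (ν : Measure (EuclideanSpace ℝ (Fin d))) [IsProbabilityMeasure ν]
    (s : ℝ) (m : ℕ) :
    ∑' k : Fin d → ℤ, ν {z | ∀ i, |gridKey s z i - k i| ≤ m} ≤ ((2 * m + 1) ^ d : ℕ) := by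
  set F : Finset (Fin d → ℤ) := Fintype.piFinset fun _ => Finset.Icc (-(m : ℤ)) m with hF
  have hcard : F.card = (2 * m + 1) ^ d := by
    rw [hF, Fintype.card_piFinset]
    simp only [Finset.prod_const, Finset.card_univ, Fintype.card_fin, Int.card_Icc]
    congr 1
    omega
  have hone : ∑' k : Fin d → ℤ, ν (gridKey s ⁻¹' {k}) = 1 := by
    have h := tsum_measure_preimage_singleton (μ := ν) (s := (univ : Set (Fin d → ℤ)))
      (Set.countable_univ) (f := gridKey s)
      (fun y _ => gridKey_meas s (measurableSet_singleton y))
    rw [tsum_univ (fun b => ν (gridKey s ⁻¹' {b}))] at h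
    simpa using h
  calc ∑' k : Fin d → ℤ, ν {z | ∀ i, |gridKey s z i - k i| ≤ m}
      ≤ ∑' k : Fin d → ℤ, ∑ e ∈ F, ν (gridKey s ⁻¹' {k + e}) := by
        apply ENNReal.tsum_le_tsum
        intro k
        refine le_trans (measure_mono ?_) (measure_biUnion_finset_le F _)
        intro z hz
        simp only [mem_iUnion]
        refine ⟨gridKey s z - k, ?_, ?_⟩
        · rw [hF, Fintype.mem_piFinset]
          intro i
          have := hz i
          rw [abs_le] at this
          simpa using this
        · simp
    _ = ∑ e ∈ F, ∑' k : Fin d → ℤ, ν (gridKey s ⁻¹' {k + e}) :=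
        Summable.tsum_finsetSum (fun i _ => ENNReal.summable)
    _ = ∑ e ∈ F, 1 := by
        apply Finset.sum_congr rfl
        intro e _
        rw [← hone]
        exact (Equiv.addRight e).tsum_eq (fun k => ν (gridKey s ⁻¹' {k}))
    _ = ((2 * m + 1) ^ d : ℕ) := by simp [hcard]
    _ ≤ _ := le_rfl

lemma kac_ineq {α : Type*} [MeasurableSpace α] (ν : Measure α) [IsProbabilityMeasure ν]
    (T : α → α) (hinv : MeasurePreserving T ν ν) (Q : Set α) (hQ : MeasurableSet Q) (N : ℕ) :
    ((N + 1 : ℕ) : ℝ≥0∞) * ν {x | x ∈ Q ∧ ∀ n, 1 ≤ n → n ≤ N → T^[n] x ∉ Q} ≤ 1 := by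
  set A := {x | x ∈ Q ∧ ∀ n, 1 ≤ n → n ≤ N → T^[n] x ∉ Q} with hA
  have hAm : MeasurableSet A := by
    have : A = Q ∩ ⋂ n : ℕ, ⋂ (_ : 1 ≤ n), ⋂ (_ : n ≤ N), (T^[n]) ⁻¹' Qᶜ := by
      ext x; simp [hA]
    rw [this]
    refine hQ.inter (MeasurableSet.iInter fun n => MeasurableSet.iInter fun _ =>
      MeasurableSet.iInter fun _ => (hinv.measurable.iterate n) hQ.compl)
  have key : ∀ j k : ℕ, j < k → k ≤ N → ∀ x, T^[j] x ∈ A → T^[k] x ∈ A → False := by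
    intro j k hjk hk x h1 h2
    apply h1.2 (k - j) (by omega) (by omega)
    rw [← Function.iterate_add_apply]
    have : k - j + j = k := by omega
    rw [this]
    exact h2.1
  have h1 : ν (⋃ k ∈ Finset.range (N + 1), (T^[k]) ⁻¹' A) =
      ∑ k ∈ Finset.range (N + 1), ν ((T^[k]) ⁻¹' A) := by
    apply measure_biUnion_finset
    · intro j hj k hk hjk
      simp only [Finset.coe_range, mem_Iio] at hj hk
      rw [Function.onFun, Set.disjoint_left]
      intro x hx hx'
      rcases lt_or_gt_of_ne hjk with h | h
      · exact key j k h (by omega) x hx hx'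
      · exact key k j h (by omega) x hx' hx
    · intro k _
      exact (hinv.measurable.iterate k) hAm
  have h2 : ∀ k ∈ Finset.range (N + 1), ν ((T^[k]) ⁻¹' A) = ν A := fun k _ =>
    (hinv.iterate k).measure_preimage hAm.nullMeasurableSet
  rw [Finset.sum_congr rfl h2] at h1
  simp only [Finset.sum_const, Finset.card_range, nsmul_eq_mul] at h1
  rw [← h1]
  exact prob_le_one

lemma geom_tsum_ne_top {θ : ℝ} (h0 : 0 < θ) (h1 : θ < 1) (C : ℝ≥0∞) (hC : C ≠ ⊤) :
    ∑' i : ℕ, ENNReal.ofReal (θ ^ i) * C ≠ ⊤ := by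
  rw [ENNReal.tsum_mul_right]
  apply ENNReal.mul_ne_top _ hC
  have := (summable_geometric_of_lt_one h0.le h1).tsum_ofReal_lt_top
  exact this.ne

lemma return_upper {d : ℕ} (ν : Measure (EuclideanSpace ℝ (Fin d))) [IsProbabilityMeasure ν]
    (T : EuclideanSpace ℝ (Fin d) → EuclideanSpace ℝ (Fin d)) (hinv : MeasurePreserving T ν ν)
    {θ : ℝ} (h0 : 0 < θ) (h1 : θ < 1) :
    ∀ᵐ x ∂ν, ∀ᶠ i : ℕ in atTop, ∃ n : ℕ, 1 ≤ n ∧ dist (T^[n] x) x < (d + 1) * (1 / 2) ^ i ∧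
      n * (ν (ball x ((1 / 2) ^ i))).toReal * θ ^ i ≤ 1 := by
  set A : ℕ → Set (EuclideanSpace ℝ (Fin d)) := fun i => {x | ¬ ∃ n : ℕ, 1 ≤ n ∧
    dist (T^[n] x) x < (d + 1) * (1 / 2) ^ i ∧
      n * (ν (ball x ((1 / 2) ^ i))).toReal * θ ^ i ≤ 1} with hA
  suffices h : ∑' i, ν (A i) ≠ ⊤ by
    filter_upwards [ae_eventually_notMem h] with x hx
    filter_upwards [hx] with i hi
    simpa [hA] using hi
  have hb : ∀ i, ν (A i) ≤ ENNReal.ofReal (θ ^ i) * ((2 * 1 + 1) ^ d : ℕ) := by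
    intro i
    set s : ℝ := (1 / 2) ^ i with hs
    have hspos : 0 < s := by positivity
    have hcube : ∀ k : Fin d → ℤ, ν (A i ∩ gridKey s ⁻¹' {k}) ≤
        ENNReal.ofReal (θ ^ i) * ν {z | ∀ j, |gridKey s z j - k j| ≤ (1 : ℕ)} := by
      intro k
      set S := {z : EuclideanSpace ℝ (Fin d) | ∀ j, |gridKey s z j - k j| ≤ (1 : ℕ)} with hS
      have hsub : gridKey s ⁻¹' {k} ⊆ S := by
        intro z hz j
        rw [mem_preimage, mem_singleton_iff] at hz
        simp [hz]
      set b := (ν S).toReal with hbdef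
      have hbS : ν S = ENNReal.ofReal b := (ENNReal.ofReal_toReal (measure_ne_top _ _)).symm
      rcases eq_or_lt_of_le (ENNReal.toReal_nonneg : 0 ≤ (ν S).toReal) with hb0 | hbpos
      · have : ν S = 0 := by rw [hbS, hbdef, ← hb0]; simp
        have : ν (A i ∩ gridKey s ⁻¹' {k}) = 0 :=
          measure_mono_null (inter_subset_right.trans hsub) this
        rw [this]; exact zero_le
      · set L : ℝ := 1 / (b * θ ^ i) with hL
        have hθ : 0 < θ ^ i := by positivity
        have hLpos : 0 < L := by positivity
        set N := ⌊L⌋₊ with hN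
        have hk := kac_ineq ν T hinv (gridKey s ⁻¹' {k})
          (gridKey_meas s (measurableSet_singleton k)) N
        have hsubset : A i ∩ gridKey s ⁻¹' {k} ⊆
            {x | x ∈ gridKey s ⁻¹' {k} ∧ ∀ n, 1 ≤ n → n ≤ N → T^[n] x ∉ gridKey s ⁻¹' {k}} := by
          rintro x ⟨hxA, hxk⟩
          refine ⟨hxk, ?_⟩
          intro n hn1 hnN hmem
          apply hxA
          rw [mem_preimage, mem_singleton_iff] at hxk hmem
          refine ⟨n, hn1, gridKey_dist hspos _ _ (hmem.trans hxk.symm), ?_⟩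
          have hball : (ν (ball x s)).toReal ≤ b := by
            apply ENNReal.toReal_mono (measure_ne_top _ _)
            apply measure_mono
            intro z hz j
            have := gridKey_near hspos 1 z x (by simpa using hz) j
            rwa [hxk] at this
          have hnL : (n : ℝ) ≤ L := le_trans (by exact_mod_cast hnN) (Nat.floor_le hLpos.le)
          calc n * (ν (ball x s)).toReal * θ ^ i ≤ L * b * θ ^ i := by gcongr
            _ = 1 := by
              have hb' : b ≠ 0 := ne_of_gt hbpos
              rw [hL]; field_simp
        refine (measure_mono hsubset).trans ?_
        set V := {x | x ∈ gridKey s ⁻¹' {k} ∧ ∀ n, 1 ≤ n → n ≤ N → T^[n] x ∉ gridKey s ⁻¹' {k}}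
        rw [hbS, ← ENNReal.ofReal_mul hθ.le]
        rw [← ENNReal.ofReal_toReal (measure_ne_top ν V)] at hk ⊢
        apply ENNReal.ofReal_le_ofReal
        have h3 : ((N + 1 : ℕ) : ℝ) * (ν V).toReal ≤ 1 := by
          have := ENNReal.toReal_mono ENNReal.one_ne_top hk
          rw [ENNReal.toReal_mul, ENNReal.toReal_natCast, ENNReal.toReal_ofReal
            ENNReal.toReal_nonneg] at this
          simpa using this
        have h4 : L < ((N + 1 : ℕ) : ℝ) := by
          push_cast; exact Nat.lt_floor_add_one L
        have h5 : L * (ν V).toReal ≤ 1 :=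
          le_trans (mul_le_mul_of_nonneg_right h4.le ENNReal.toReal_nonneg) h3
        rw [hL, one_div, inv_mul_le_iff₀ (by positivity)] at h5
        linarith
    calc ν (A i) ≤ ν (⋃ k : Fin d → ℤ, A i ∩ gridKey s ⁻¹' {k}) := by
          apply measure_mono
          intro x hx
          simp only [mem_iUnion]
          exact ⟨gridKey s x, hx, rfl⟩
      _ ≤ ∑' k : Fin d → ℤ, ν (A i ∩ gridKey s ⁻¹' {k}) := measure_iUnion_le _
      _ ≤ ∑' k : Fin d → ℤ, ENNReal.ofReal (θ ^ i) *
            ν {z | ∀ j, |gridKey s z j - k j| ≤ (1 : ℕ)} := ENNReal.tsum_le_tsum hcube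
      _ ≤ _ := by
          rw [ENNReal.tsum_mul_left]
          gcongr
          exact gridKey_overlap ν s 1
  exact ne_top_of_le_ne_top (geom_tsum_ne_top h0 h1 _ (ENNReal.natCast_ne_top _))
    (ENNReal.tsum_le_tsum hb)

lemma ball_lower {d : ℕ} (ν : Measure (EuclideanSpace ℝ (Fin d))) [IsProbabilityMeasure ν] :
    ∀ᵐ x ∂ν, ∃ C : ℝ, 0 < C ∧ ∀ᶠ r : ℝ in 𝓝[>] 0, C * r ^ d ≤ (ν (ball x r)).toReal := by
  filter_upwards [Besicovitch.ae_tendsto_rnDeriv (volume : Measure (EuclideanSpace ℝ (Fin d))) ν,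
    Measure.rnDeriv_lt_top (volume : Measure (EuclideanSpace ℝ (Fin d))) ν] with x h1 h2
  obtain ⟨M, hM1, hM2⟩ := ENNReal.lt_iff_exists_nnreal_btwn.1 h2
  have hev := h1.eventually (gt_mem_nhds hM1)
  set v := (volume (ball (0 : EuclideanSpace ℝ (Fin d)) 1)).toReal with hv
  have hvpos : 0 < v := by
    apply ENNReal.toReal_pos
    · exact (measure_ball_pos _ _ one_pos).ne'
    · exact measure_ball_lt_top.ne
  have hev2 : ∀ᶠ r : ℝ in 𝓝[>] 0, v / (M + 1) * r ^ d ≤ (ν (closedBall x r)).toReal := by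
    filter_upwards [hev, self_mem_nhdsWithin] with r hr hr0
    have hr0 : (0:ℝ) < r := hr0
    have hMlt : volume (closedBall x r) ≤ M * ν (closedBall x r) := by
      exact (ENNReal.div_le_iff_le_mul (Or.inr ENNReal.coe_ne_top)
        (Or.inl (measure_ne_top _ _))).1 hr.le
    rw [Measure.addHaar_closedBall _ _ hr0.le] at hMlt
    have := ENNReal.toReal_mono (ENNReal.mul_ne_top ENNReal.coe_ne_top (measure_ne_top _ _)) hMlt
    rw [ENNReal.toReal_mul, ENNReal.toReal_mul, ENNReal.toReal_ofReal (by positivity),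
      finrank_euclideanSpace_fin, ENNReal.coe_toReal, ← hv] at this
    rw [div_mul_eq_mul_div, div_le_iff₀ (by positivity)]
    nlinarith [(ENNReal.toReal_nonneg : 0 ≤ (ν (closedBall x r)).toReal)]
  refine ⟨v / (M + 1) * (1 / 2) ^ d, by positivity, ?_⟩
  have ht : Tendsto (fun r : ℝ => r / 2) (𝓝[>] 0) (𝓝[>] 0) := by
    apply tendsto_nhdsWithin_of_tendsto_nhds_of_eventually_within
    · have : Tendsto (fun r : ℝ => r / 2) (𝓝 0) (𝓝 (0 / 2)) := tendsto_id.div_const 2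
      rw [zero_div] at this
      exact this.mono_left nhdsWithin_le_nhds
    · filter_upwards [self_mem_nhdsWithin] with r hr
      exact half_pos (show (0:ℝ) < r from hr)
  filter_upwards [ht.eventually hev2, self_mem_nhdsWithin] with r hr hr0
  have hr0 : (0:ℝ) < r := hr0
  calc v / (M + 1) * (1 / 2) ^ d * r ^ d = v / (M + 1) * (r / 2) ^ d := by
        rw [mul_assoc, ← mul_pow]; congr 2; ring
    _ ≤ _ := hr
    _ ≤ _ := by
      apply ENNReal.toReal_mono (measure_ne_top _ _)
      apply measure_mono
      apply closedBall_subset_ball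
      linarith

/-- decay bound in the form used below -/
lemma corr_bound {d : ℕ} (X : Set (EuclideanSpace ℝ (Fin d)))
    (T : EuclideanSpace ℝ (Fin d) → EuclideanSpace ℝ (Fin d))
    (ν : Measure (EuclideanSpace ℝ (Fin d))) [IsProbabilityMeasure ν]
    (hinv : MeasurePreserving T ν ν)
    (hdec : ∀ p : ℝ, 0 < p → ∃ Cp > (0 : ℝ),
      ∀ f g : EuclideanSpace ℝ (Fin d) → ℝ, ∀ Kf Lf Kg Lg : ℝ,
      (∀ x ∈ X, |f x| ≤ Kf) → (∀ x ∈ X, ∀ y ∈ X, |f x - f y| ≤ Lf * dist x y) →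
      (∀ x ∈ X, |g x| ≤ Kg) → (∀ x ∈ X, ∀ y ∈ X, |g x - g y| ≤ Lg * dist x y) →
      Measurable f → Measurable g →
      ∀ n : ℕ, 1 ≤ n →
        |(∫ x, f x * g (T^[n] x) ∂ν) - (∫ x, f x ∂ν) * ∫ x, g x ∂ν|
          ≤ Cp * (n : ℝ) ^ (-p) * (Kf + Lf) * (Kg + Lg)) (p : ℕ) (hp : 0 < p) :
    ∃ C : ℝ, 0 < C ∧ ∀ n : ℕ, 1 ≤ n → ∀ s : ℝ, 0 < s → s ≤ 1 → ∀ y,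
      ν {x | gridKey s x = gridKey s y ∧ dist (T^[n] x) x < s} ≤
        ENNReal.ofReal ((ν (ball y (2 * (d + 2) * s))).toReal ^ 2 + C * (1 / (n : ℝ) ^ p) / s ^ 2) := by
  obtain ⟨C, hC, h⟩ := hdec p (by exact_mod_cast hp)
  refine ⟨C * 4, by positivity, ?_⟩
  intro n hn s hs hs1 y
  set ρ : ℝ := (d + 2) * s with hρ
  have hρpos : 0 < ρ := by positivity
  have hsρ : s ≤ ρ := by
    rw [hρ]; nlinarith [(Nat.cast_nonneg d : (0:ℝ) ≤ d)]
  set f : EuclideanSpace ℝ (Fin d) → ℝ := fun z => max 0 (min 1 (2 - dist z y / ρ)) with hf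
  have f0 : ∀ z, 0 ≤ f z := fun z => le_max_left _ _
  have f1 : ∀ z, f z ≤ 1 := fun z => max_le zero_le_one (min_le_left _ _)
  have fcont : Continuous f := by rw [hf]; fun_prop
  have fmeas : Measurable f := fcont.measurable
  have fabs : ∀ z, |f z| ≤ 1 := fun z => by rw [abs_of_nonneg (f0 z)]; exact f1 z
  have flip : ∀ x z, |f x - f z| ≤ 1 / s * dist x z := by
    intro x z
    calc |f x - f z| ≤ |(min 1 (2 - dist x y / ρ)) - (min 1 (2 - dist z y / ρ))| :=
by
          have := abs_max_sub_max_le_max 0 (min 1 (2 - dist x y / ρ)) 0 (min 1 (2 - dist z y / ρ))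
          simpa using this
      _ ≤ |(2 - dist x y / ρ) - (2 - dist z y / ρ)| := by
          have := abs_min_sub_min_le_max 1 (2 - dist x y / ρ) 1 (2 - dist z y / ρ)
          simpa using this
      _ = |dist x y - dist z y| / ρ := by
          rw [show (2 - dist x y / ρ) - (2 - dist z y / ρ) = -((dist x y - dist z y) / ρ) by ring,
            abs_neg, abs_div, abs_of_pos hρpos]
      _ ≤ dist x z / s := by
          gcongr
          exact abs_dist_sub_le x z y
      _ = 1 / s * dist x z := by ring
  have key := h f f 1 (1 / s) 1 (1 / s) (fun x _ => fabs x) (fun x _ z _ => flip x z)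
    (fun x _ => fabs x) (fun x _ z _ => flip x z) fmeas fmeas n hn
  have hTm : Measurable (T^[n]) := hinv.measurable.iterate n
  have hint : Integrable (fun x => f x * f (T^[n] x)) ν := by
    apply Integrable.of_bound (C := 1)
    · exact (fmeas.mul (fmeas.comp hTm)).aestronglyMeasurable
    · apply ae_of_all
      intro x
      rw [Real.norm_eq_abs, abs_mul]
      exact mul_le_one₀ (fabs _) (abs_nonneg _) (fabs _)
  have hfint : Integrable f ν := by
    apply Integrable.of_bound (C := 1) fmeas.aestronglyMeasurable
    exact ae_of_all _ fabs
  set b := (ν (ball y (2 * (d + 2) * s))).toReal with hb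
  have hfb : ∫ x, f x ∂ν ≤ b := by
    calc ∫ x, f x ∂ν ≤ ∫ x, (ball y (2 * (d + 2) * s)).indicator (fun _ => (1:ℝ)) x ∂ν := by
          apply integral_mono hfint
          · exact (integrable_const _).indicator measurableSet_ball
          intro z
          by_cases hz : z ∈ ball y (2 * (d + 2) * s)
          · simp only [hz, indicator_of_mem]; exact f1 z
          · simp only [hz, not_false_eq_true, indicator_of_notMem]
            rw [mem_ball, not_lt] at hz
            simp only [hf]
            apply max_le le_rfl
            apply min_le_iff.2; right
            rw [sub_nonpos, le_div_iff₀ hρpos, hρ]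
            linarith
      _ = b := by
          rw [integral_indicator_const _ measurableSet_ball]
          simp [hb, Measure.real]
  have hfnn : 0 ≤ ∫ x, f x ∂ν := integral_nonneg f0
  set U := {x | gridKey s x = gridKey s y ∧ dist (T^[n] x) x < s} with hU
  have hUm : MeasurableSet U := by
    apply MeasurableSet.inter
    · exact gridKey_meas s (measurableSet_singleton (gridKey s y))
    · exact measurableSet_lt (hTm.dist measurable_id) measurable_const
  have hUle : (ν U).toReal ≤ ∫ x, f x * f (T^[n] x) ∂ν := by
    calc (ν U).toReal = ∫ x, U.indicator (fun _ => (1:ℝ)) x ∂ν := by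
          rw [integral_indicator_const _ hUm]
          simp [Measure.real]
      _ ≤ _ := by
          apply integral_mono ((integrable_const _).indicator hUm) hint
          intro z
          by_cases hz : z ∈ U
          · simp only [hz, indicator_of_mem]
            have hd := gridKey_dist hs z y hz.1
            have one : ∀ w, dist w y < ρ → f w = 1 := by
              intro w hw
              simp only [hf]
              rw [min_eq_left, max_eq_right zero_le_one]
              have := (div_lt_one hρpos).2 hw
              linarith
            rw [one z (by rw [hρ]; linarith), one (T^[n] z)]
            · norm_num
            · have := dist_triangle (T^[n] z) z y
              have := hz.2
              rw [hρ]; linarith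
          · simp only [hz, not_false_eq_true, indicator_of_notMem]
            exact mul_nonneg (f0 _) (f0 _)
  rw [← ENNReal.ofReal_toReal (measure_ne_top ν U)]
  apply ENNReal.ofReal_le_ofReal
  have e1 := (abs_le.1 key).2
  have e2 : (∫ x, f x ∂ν) * ∫ x, f x ∂ν ≤ b ^ 2 := by nlinarith
  have e3 : C * (n : ℝ) ^ (-(p:ℝ)) * (1 + 1 / s) * (1 + 1 / s) ≤ C * 4 * (1 / (n : ℝ) ^ p) / s ^ 2 := by
    rw [Real.rpow_neg (Nat.cast_nonneg n), Real.rpow_natCast]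
    have : 1 + 1 / s ≤ 2 / s := by
      have : 1 ≤ 1 / s := by rw [le_div_iff₀ hs]; linarith
      have : 2 / s = 1 / s + 1 / s := by ring
      linarith
    calc C * ((n : ℝ) ^ p)⁻¹ * (1 + 1 / s) * (1 + 1 / s)
        ≤ C * ((n : ℝ) ^ p)⁻¹ * (2 / s) * (2 / s) := by gcongr
      _ = _ := by field_simp; ring
  linarith

lemma cube_sum {d : ℕ} (ν : Measure (EuclideanSpace ℝ (Fin d))) [IsProbabilityMeasure ν]
    (A : Set (EuclideanSpace ℝ (Fin d))) {s R α β : ℝ} (hs : 0 < s) (hs1 : s ≤ 1) (hR : 0 ≤ R)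
    (hβ : 0 ≤ β)
    (hA : ∀ x ∈ A, dist x 0 < R)
    (h : ∀ y ∈ A, ν (A ∩ {x | gridKey s x = gridKey s y}) ≤
      ENNReal.ofReal α * ν (ball y (2 * (d + 2) * s)) + ENNReal.ofReal β) :
    ν A ≤ ENNReal.ofReal α * ((2 * (2 * (d + 2)) + 1) ^ d : ℕ) +
      ENNReal.ofReal (β * ((2 * R + 3) / s) ^ d) := by
  obtain ⟨F, hF, hcard⟩ := gridKey_count (d := d) hs hs1 hR
  have hk : ∀ k : Fin d → ℤ, ν (A ∩ {x | gridKey s x = k}) ≤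
      ENNReal.ofReal α * ν {z | ∀ i, |gridKey s z i - k i| ≤ (2 * (d + 2) : ℕ)}
        + ENNReal.ofReal β := by
    intro k
    rcases (A ∩ {x | gridKey s x = k}).eq_empty_or_nonempty with he | ⟨y, hyA, hyk⟩
    · rw [he]; simp
    · have hyk : gridKey s y = k := hyk
      subst hyk
      refine (h y hyA).trans ?_
      gcongr
      intro z hz i
      apply gridKey_near hs
      push_cast
      exact hz
  calc ν A ≤ ν (⋃ k ∈ F, A ∩ {x | gridKey s x = k}) := by
        apply measure_mono
        intro x hx
        simp only [mem_iUnion]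
        exact ⟨gridKey s x, hF x (hA x hx), hx, rfl⟩
    _ ≤ ∑ k ∈ F, ν (A ∩ {x | gridKey s x = k}) := measure_biUnion_finset_le _ _
    _ ≤ ∑ k ∈ F, (ENNReal.ofReal α * ν {z | ∀ i, |gridKey s z i - k i| ≤ (2 * (d + 2) : ℕ)}
        + ENNReal.ofReal β) := Finset.sum_le_sum fun k _ => hk k
    _ = ENNReal.ofReal α * ∑ k ∈ F, ν {z | ∀ i, |gridKey s z i - k i| ≤ (2 * (d + 2) : ℕ)}
        + F.card * ENNReal.ofReal β := by
        rw [Finset.sum_add_distrib, ← Finset.mul_sum]; simp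
    _ ≤ _ := by
        gcongr
        · exact (ENNReal.sum_le_tsum F).trans (gridKey_overlap ν s (2 * (d + 2)))
        · rw [← ENNReal.ofReal_natCast, ← ENNReal.ofReal_mul (Nat.cast_nonneg _)]
          apply ENNReal.ofReal_le_ofReal
          rw [mul_comm]
          gcongr

/-- the form of decay used below -/
def CorrBound {d : ℕ} (ν : Measure (EuclideanSpace ℝ (Fin d)))
    (T : EuclideanSpace ℝ (Fin d) → EuclideanSpace ℝ (Fin d)) : Prop :=
  ∀ p : ℕ, 0 < p → ∃ C : ℝ, 0 < C ∧ ∀ n : ℕ, 1 ≤ n → ∀ s : ℝ, 0 < s → s ≤ 1 → ∀ y,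
      ν {x | gridKey s x = gridKey s y ∧ dist (T^[n] x) x < s} ≤
        ENNReal.ofReal ((ν (ball y (2 * (d + 2) * s))).toReal ^ 2 + C * (1 / (n : ℝ) ^ p) / s ^ 2)

lemma no_fast_return {d : ℕ} (ν : Measure (EuclideanSpace ℝ (Fin d))) [IsProbabilityMeasure ν]
    (T : EuclideanSpace ℝ (Fin d) → EuclideanSpace ℝ (Fin d)) (hcor : CorrBound ν T)
    (R l j : ℕ) :
    ∀ᵐ x ∂ν, dist x 0 < R →
      (∀ s : ℝ, 0 < s → s < 1 / (j + 1) → (ν (ball x s)).toReal ^ (l + 1) ≤ s) →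
      ∀ᶠ n : ℕ in atTop, (1 / (n : ℝ)) ^ (2 * (l + 1)) ≤ dist (T^[n] x) x := by
  set q := 2 * (l + 1) with hq
  obtain ⟨C, hC, hcor⟩ := hcor (2 + 2 * q + q * d) (by omega)
  set A : ℕ → Set (EuclideanSpace ℝ (Fin d)) := fun n => {x | dist x 0 < R ∧
      (∀ s : ℝ, 0 < s → s < 1 / (j + 1) → (ν (ball x s)).toReal ^ (l + 1) ≤ s) ∧
      1 ≤ n ∧ 2 * (d + 2) * (1 / (n : ℝ)) ^ q < 1 / (j + 1) ∧
      dist (T^[n] x) x < (1 / (n : ℝ)) ^ q} with hA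
  suffices h : ∑' n, ν (A n) ≠ ⊤ by
    filter_upwards [ae_eventually_notMem h] with x hx hxR hxG
    have ht : Tendsto (fun n : ℕ => 2 * ((d:ℝ) + 2) * (1 / (n : ℝ)) ^ q) atTop (𝓝 0) := by
      have h1 : Tendsto (fun n : ℕ => (1 / (n : ℝ)) ^ q) atTop (𝓝 (0 ^ q)) :=
        tendsto_one_div_atTop_nhds_zero_nat.pow q
      rw [zero_pow (by omega)] at h1
      simpa using h1.const_mul (2 * ((d:ℝ) + 2))
    have hj : (0:ℝ) < 1 / (j + 1) := by positivity
    filter_upwards [hx, ht.eventually (gt_mem_nhds hj), eventually_ge_atTop 1] with n h1 h2 h3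
    by_contra hcon
    exact h1 ⟨hxR, hxG, h3, h2, not_le.1 hcon⟩
  set M : ℝ := (((2 * (2 * (d + 2)) + 1) ^ d : ℕ) : ℝ) with hM
  set B : ℝ := 2 * (d + 2) * M + C * (2 * R + 3) ^ d with hB
  have hb : ∀ n, ν (A n) ≤ ENNReal.ofReal (B * (1 / (n : ℝ) ^ 2)) := by
    intro n
    rcases Nat.eq_zero_or_pos n with h0 | hn
    · have : A n = ∅ := by
        ext x; simp [hA, h0]
      rw [this]; simp
    have hn' : (1:ℝ) ≤ n := by exact_mod_cast hn
    have hn0 : (0:ℝ) < n := by linarith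
    set s : ℝ := (1 / (n : ℝ)) ^ q with hs
    have hspos : 0 < s := by positivity
    have hs1 : s ≤ 1 := by
      apply pow_le_one₀ (by positivity)
      rw [div_le_one hn0]; exact hn'
    have hsum := cube_sum ν (A n) (s := s) (R := R) (α := 2 * (d + 2) * (1 / (n:ℝ) ^ 2))
      (β := C * (1 / (n : ℝ) ^ (2 + 2 * q + q * d)) / s ^ 2) hspos hs1 (Nat.cast_nonneg R)
      (by positivity) (fun x hx => hx.1) (by
        intro y hy
        refine (measure_mono ?_).trans ((hcor n hn s hspos hs1 y).trans ?_)
        · rintro x ⟨hx, hx2⟩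
          exact ⟨hx2, hx.2.2.2.2⟩
        · set b := (ν (ball y (2 * (d + 2) * s))).toReal with hbd
          have hbn : 0 ≤ b := ENNReal.toReal_nonneg
          have hb1 : b ^ (l + 1) ≤ 2 * (d + 2) * s := hy.2.1 _ (by positivity) hy.2.2.2.1
          have hb2 : b ≤ 2 * (d + 2) * (1 / (n:ℝ) ^ 2) := by
            apply le_of_pow_le_pow_left₀ (n := l + 1) (by omega) (by positivity)
            refine hb1.trans ?_
            rw [mul_pow]
            have e1 : s = (1 / (n:ℝ) ^ 2) ^ (l + 1) := by
              rw [hs, hq, pow_mul, one_div_pow]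
            rw [e1]
            gcongr
            apply le_self_pow₀
            · nlinarith [(Nat.cast_nonneg d : (0:ℝ) ≤ d)]
            · omega
          have hbν : ν (ball y (2 * (d + 2) * s)) = ENNReal.ofReal b :=
            (ENNReal.ofReal_toReal (measure_ne_top _ _)).symm
          rw [hbν, ← ENNReal.ofReal_mul (by positivity),
            ← ENNReal.ofReal_add (by positivity) (by positivity)]
          apply ENNReal.ofReal_le_ofReal
          have : b ^ 2 ≤ 2 * (d + 2) * (1 / (n:ℝ) ^ 2) * b := by
            rw [sq]; exact mul_le_mul_of_nonneg_right hb2 hbn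
          linarith)
    refine hsum.trans ?_
    rw [← ENNReal.ofReal_natCast, ← ENNReal.ofReal_mul (by positivity),
            ← ENNReal.ofReal_add (by positivity) (by positivity)]
    apply ENNReal.ofReal_le_ofReal
    rw [← hM, hB, hs]
    apply le_of_eq
    rw [div_pow _ _ d]
    simp only [one_div, inv_pow, ← pow_mul]
    rw [pow_add, pow_add, mul_comm 2 q]
    field_simp
  refine ne_top_of_le_ne_top ?_ (ENNReal.tsum_le_tsum hb)
  have hsm : Summable (fun n : ℕ => B * (1 / (n : ℝ) ^ 2)) :=
    (Real.summable_one_div_nat_pow.2 (by norm_num)).mul_left B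
  exact hsm.tsum_ofReal_lt_top.ne

lemma count_sum {b S : ℝ} (hb : 0 ≤ b) (hS : 0 ≤ S) :
    ∑' n : ℕ, (if 1 ≤ n ∧ n * b ≤ S then ENNReal.ofReal (b ^ 2) else 0) ≤
      ENNReal.ofReal S * ENNReal.ofReal b := by
  rcases eq_or_lt_of_le hb with h0 | hpos
  · rw [← h0]; simp
  · rw [tsum_eq_sum (s := Finset.Icc 1 ⌊S / b⌋₊)]
    · calc ∑ n ∈ Finset.Icc 1 ⌊S / b⌋₊, (if 1 ≤ n ∧ n * b ≤ S then ENNReal.ofReal (b ^ 2) else 0)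
          ≤ ∑ n ∈ Finset.Icc 1 ⌊S / b⌋₊, ENNReal.ofReal (b ^ 2) := by
            apply Finset.sum_le_sum
            intro n _
            split_ifs <;> simp
        _ = ⌊S / b⌋₊ * ENNReal.ofReal (b ^ 2) := by simp
        _ ≤ _ := by
            rw [← ENNReal.ofReal_natCast, ← ENNReal.ofReal_mul (Nat.cast_nonneg _),
              ← ENNReal.ofReal_mul hS]
            apply ENNReal.ofReal_le_ofReal
            have := Nat.floor_le (a := S / b) (by positivity)
            rw [le_div_iff₀ hpos] at this
            nlinarith
    · intro n hn
      rw [if_neg]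
      rintro ⟨h1, h2⟩
      apply hn
      rw [Finset.mem_Icc]
      refine ⟨h1, Nat.le_floor ?_⟩
      rwa [le_div_iff₀ hpos]

lemma return_lower {d : ℕ} (ν : Measure (EuclideanSpace ℝ (Fin d))) [IsProbabilityMeasure ν]
    (T : EuclideanSpace ℝ (Fin d) → EuclideanSpace ℝ (Fin d)) (hcor : CorrBound ν T)
    (R q : ℕ) {θ : ℝ} (h0 : 0 < θ) (h1 : θ < 1) :
    ∀ᵐ x ∂ν, dist x 0 < R → ∀ᶠ i : ℕ in atTop, ∀ n : ℕ, 1 ≤ n →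
      1 ≤ (1 / 2) ^ i * (n : ℝ) ^ q → dist (T^[n] x) x < (1 / 2) ^ i →
      θ ^ i < n * (ν (ball x (3 * (d + 2) * (1 / 2) ^ i))).toReal := by
  obtain ⟨C, hC, hcor⟩ := hcor (2 + q * (d + 3)) (by omega)
  set A : ℕ → Set (EuclideanSpace ℝ (Fin d)) := fun i => {x | dist x 0 < R ∧
      ∃ n : ℕ, 1 ≤ n ∧ 1 ≤ (1 / 2) ^ i * (n : ℝ) ^ q ∧ dist (T^[n] x) x < (1 / 2) ^ i ∧
      n * (ν (ball x (3 * (d + 2) * (1 / 2) ^ i))).toReal ≤ θ ^ i} with hA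
  suffices h : ∑' n, ν (A n) ≠ ⊤ by
    filter_upwards [ae_eventually_notMem h] with x hx hxR
    filter_upwards [hx] with i hi n hn hnq hd
    by_contra hcon
    exact hi ⟨hxR, n, hn, hnq, hd, not_lt.1 hcon⟩
  have hsmZ : Summable (fun n : ℕ => 1 / (n : ℝ) ^ 2) :=
    Real.summable_one_div_nat_pow.2 (by norm_num)
  set Z : ℝ := ∑' n : ℕ, 1 / (n : ℝ) ^ 2 with hZ
  have hZ0 : 0 ≤ Z := tsum_nonneg fun n => by positivity
  have hb : ∀ i, ν (A i) ≤ ENNReal.ofReal (θ ^ i) * ((2 * (2 * (d + 2)) + 1) ^ d : ℕ) +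
      ENNReal.ofReal ((1 / 2) ^ i) * ENNReal.ofReal (C * Z * (2 * R + 3) ^ d) := by
    intro i
    set s : ℝ := (1 / 2) ^ i with hs
    have hspos : 0 < s := by positivity
    have hs1 : s ≤ 1 := pow_le_one₀ (by norm_num) (by norm_num)
    have hsum := cube_sum ν (A i) (s := s) (R := R) (α := θ ^ i)
      (β := C * Z * s ^ (d + 1)) hspos hs1 (Nat.cast_nonneg R)
      (by positivity) (fun x hx => hx.1) (by
        intro y hy
        set b := (ν (ball y (2 * (d + 2) * s))).toReal with hbd
        have hbn : 0 ≤ b := ENNReal.toReal_nonneg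
        have hbν : ν (ball y (2 * (d + 2) * s)) = ENNReal.ofReal b :=
            (ENNReal.ofReal_toReal (measure_ne_top _ _)).symm
        set W : ℕ → Set (EuclideanSpace ℝ (Fin d)) := fun n =>
          {x | (1 ≤ n ∧ 1 ≤ s * (n : ℝ) ^ q ∧ n * b ≤ θ ^ i) ∧
            (gridKey s x = gridKey s y ∧ dist (T^[n] x) x < s)} with hW
        have hsub : A i ∩ {x | gridKey s x = gridKey s y} ⊆ ⋃ n, W n := by
          rintro x ⟨⟨_, n, hn, hnq, hd, hnb⟩, hx2⟩
          simp only [mem_iUnion]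
          refine ⟨n, ⟨hn, hnq, le_trans ?_ hnb⟩, hx2, hd⟩
          gcongr
          apply ENNReal.toReal_mono (measure_ne_top _ _)
          apply measure_mono
          apply ball_subset_ball'
          have hx2 : gridKey s x = gridKey s y := hx2
          have := gridKey_dist hspos y x hx2.symm
          nlinarith
        have hWn : ∀ n, ν (W n) ≤ (if 1 ≤ n ∧ n * b ≤ θ ^ i then ENNReal.ofReal (b ^ 2) else 0) +
            ENNReal.ofReal (C * s ^ (d + 1) * (1 / (n : ℝ) ^ 2)) := by
          intro n
          by_cases hc : 1 ≤ n ∧ 1 ≤ s * (n : ℝ) ^ q ∧ n * b ≤ θ ^ i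
          · rw [if_pos ⟨hc.1, hc.2.2⟩]
            refine (measure_mono (fun x hx => hx.2)).trans ((hcor n hc.1 s hspos hs1 y).trans ?_)
            rw [← hbd, ← ENNReal.ofReal_add (by positivity) (by positivity)]
            apply ENNReal.ofReal_le_ofReal
            have hn0 : (0:ℝ) < n := by exact_mod_cast hc.1
            have e1 : 1 / (n:ℝ) ^ q ≤ s := by
              rw [div_le_iff₀ (by positivity)]; exact hc.2.1
            have e2 : 1 / (n : ℝ) ^ (2 + q * (d + 3)) ≤ 1 / (n:ℝ) ^ 2 * s ^ (d + 3) := by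
              have e0 : 1 / (n : ℝ) ^ (2 + q * (d + 3)) =
                  1 / (n:ℝ) ^ 2 * (1 / (n:ℝ) ^ q) ^ (d + 3) := by
                rw [pow_add, pow_mul, one_div_pow, one_div_mul_one_div]
              rw [e0]
              gcongr
            have e3 : C * (1 / (n : ℝ) ^ (2 + q * (d + 3))) / s ^ 2 ≤
                C * s ^ (d + 1) * (1 / (n : ℝ) ^ 2) := by
              rw [div_le_iff₀ (by positivity)]
              calc C * (1 / (n : ℝ) ^ (2 + q * (d + 3))) ≤ C * (1 / (n:ℝ) ^ 2 * s ^ (d + 3)) := by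
                    gcongr
                _ = _ := by ring
            linarith
          · have : W n = ∅ := by
              ext x; simp [hW, hc]
            rw [this]; simp
        calc ν (A i ∩ {x | gridKey s x = gridKey s y}) ≤ ∑' n, ν (W n) :=
              (measure_mono hsub).trans (measure_iUnion_le _)
          _ ≤ ∑' n : ℕ, ((if 1 ≤ n ∧ n * b ≤ θ ^ i then ENNReal.ofReal (b ^ 2) else 0) +
            ENNReal.ofReal (C * s ^ (d + 1) * (1 / (n : ℝ) ^ 2))) := ENNReal.tsum_le_tsum hWn
          _ = ∑' n : ℕ, (if 1 ≤ n ∧ n * b ≤ θ ^ i then ENNReal.ofReal (b ^ 2) else 0) +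
            ∑' n : ℕ, ENNReal.ofReal (C * s ^ (d + 1) * (1 / (n : ℝ) ^ 2)) := ENNReal.tsum_add
          _ ≤ _ := by
            rw [hbν]
            refine add_le_add (count_sum hbn (by positivity)) ?_
            rw [← ENNReal.ofReal_tsum_of_nonneg (fun n => by positivity) (hsmZ.mul_left _),
              tsum_mul_left]
            apply ENNReal.ofReal_le_ofReal
            apply le_of_eq
            rw [← hZ]; ring)
    refine hsum.trans ?_
    gcongr
    rw [← ENNReal.ofReal_mul (by positivity)]
    apply ENNReal.ofReal_le_ofReal
    apply le_of_eq
    rw [div_pow]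
    field_simp
    ring
  refine ne_top_of_le_ne_top ?_ (ENNReal.tsum_le_tsum hb)
  rw [ENNReal.tsum_add]
  exact ENNReal.add_ne_top.2 ⟨geom_tsum_ne_top h0 h1 _ (ENNReal.natCast_ne_top _),
    geom_tsum_ne_top (by norm_num) (by norm_num) _ ENNReal.ofReal_ne_top⟩

lemma scale_tendsto {K : ℝ} (hK : 0 < K) : Tendsto (fun r : ℝ => r * K) (𝓝[>] 0) (𝓝[>] 0) := by
  apply tendsto_nhdsWithin_of_tendsto_nhds_of_eventually_within
  · have : Tendsto (fun r : ℝ => r * K) (𝓝 0) (𝓝 (0 * K)) := tendsto_id.mul_const K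
    rw [zero_mul] at this
    exact this.mono_left nhdsWithin_le_nhds
  · filter_upwards [self_mem_nhdsWithin] with r hr
    exact mul_pos (show (0:ℝ) < r from hr) hK

lemma scale_tendsto' {K : ℝ} (hK : 0 < K) : Tendsto (fun r : ℝ => r / K) (𝓝[>] 0) (𝓝[>] 0) := by
  simpa [div_eq_mul_inv] using scale_tendsto (inv_pos.2 hK)

lemma lim_compare (u v : ℝ → ℝ) {K M : ℝ} (hK : 0 < K)
    (hu0 : ∀ᶠ r in 𝓝[>] 0, 0 ≤ u r) (huM : ∀ᶠ r in 𝓝[>] 0, u r ≤ M)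
    (hv0 : ∀ᶠ r in 𝓝[>] 0, 0 ≤ v r) (hvM : ∀ᶠ r in 𝓝[>] 0, v r ≤ M)
    (h : ∀ ε : ℝ, 0 < ε → ∀ᶠ r in 𝓝[>] 0, v r ≤ u (r / K) + ε) :
    limsup v (𝓝[>] 0) ≤ limsup u (𝓝[>] 0) ∧ liminf v (𝓝[>] 0) ≤ liminf u (𝓝[>] 0) := by
  have bu : IsBoundedUnder (· ≤ ·) (𝓝[>] (0:ℝ)) u := ⟨M, huM⟩
  have bu' : IsBoundedUnder (· ≥ ·) (𝓝[>] (0:ℝ)) u := ⟨0, hu0⟩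
  have bv : IsBoundedUnder (· ≤ ·) (𝓝[>] (0:ℝ)) v := ⟨M, hvM⟩
  have bv' : IsBoundedUnder (· ≥ ·) (𝓝[>] (0:ℝ)) v := ⟨0, hv0⟩
  constructor
  · apply le_of_forall_pos_le_add
    intro ε hε
    apply limsup_le_of_le bv'.isCoboundedUnder_le
    have h1 : ∀ᶠ r in 𝓝[>] 0, u r < limsup u (𝓝[>] 0) + ε / 2 :=
      eventually_lt_of_limsup_lt (by linarith) bu
    filter_upwards [(scale_tendsto' hK).eventually h1, h (ε / 2) (by linarith)] with r h2 h3
    linarith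
  · apply le_of_forall_pos_le_add
    intro ε hε
    rw [← sub_le_iff_le_add]
    apply le_liminf_of_le bu.isCoboundedUnder_ge
    have h1 : ∀ᶠ r in 𝓝[>] 0, liminf v (𝓝[>] 0) - ε / 2 < v r :=
      eventually_lt_of_lt_liminf (by linarith) bv'
    filter_upwards [(scale_tendsto hK).eventually h1,
      (scale_tendsto hK).eventually (h (ε / 2) (by linarith))] with r h2 h3
    rw [mul_div_cancel_right₀ _ hK.ne'] at h3
    linarith

/-- one-sided comparison with normalisation by `-log r` -/
lemma norm_compare (P Q : ℝ → ℝ) {K M : ℝ} (hK : 1 ≤ K) (hM : 0 ≤ M)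
    (hPM : ∀ᶠ r in 𝓝[>] 0, P r ≤ M * (-Real.log r))
    (h : ∀ ε : ℝ, 0 < ε → ∀ᶠ r in 𝓝[>] 0, Q r ≤ P (r / K) + ε * (-Real.log (r / K))) :
    ∀ ε : ℝ, 0 < ε → ∀ᶠ r in 𝓝[>] 0,
      Q r / (-Real.log r) ≤ P (r / K) / (-Real.log (r / K)) + ε := by
  intro ε hε
  have hK0 : 0 < K := by linarith
  have hlogK : 0 ≤ Real.log K := Real.log_nonneg hK
  have ht : Tendsto (fun r : ℝ => -Real.log r) (𝓝[>] 0) atTop :=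
    tendsto_neg_atBot_atTop.comp Real.tendsto_log_nhdsGT_zero
  have hbig := ht.eventually (eventually_ge_atTop ((M + ε) * Real.log K / (ε / 2) + 1))
  filter_upwards [hbig, h (ε / 2) (by linarith), (scale_tendsto' hK0).eventually hPM,
    self_mem_nhdsWithin] with r h1 h2 h3 h4
  have h4 : (0:ℝ) < r := h4
  have hL : -Real.log (r / K) = -Real.log r + Real.log K := by
    rw [Real.log_div h4.ne' hK0.ne']; ring
  rw [hL] at h2 h3 ⊢
  set L := -Real.log r with hLd
  set k := Real.log K with hk
  have hLpos : 0 < L := by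
    have : 0 ≤ (M + ε) * k / (ε / 2) := by positivity
    linarith
  have hLk : 0 < L + k := by linarith
  have h5 : (M + ε) * k ≤ (ε / 2) * L := by
    have : (M + ε) * k / (ε / 2) ≤ L := by linarith
    rw [div_le_iff₀ (by positivity)] at this
    linarith
  rw [div_le_iff₀ hLpos]
  set w := P (r / K) / (L + k) with hw
  have hPw : P (r / K) = w * (L + k) := by rw [hw]; field_simp
  have hwM : w ≤ M := by rw [hw, div_le_iff₀ hLk]; exact h3
  rw [hPw] at h2
  nlinarith [mul_le_mul_of_nonneg_right hwM hlogK]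

lemma real_core (P Q : ℝ → ℝ) {K M : ℝ} (hK : 1 ≤ K) (hM : 0 ≤ M)
    (hP0 : ∀ r, 0 < r → 0 ≤ P r) (hQ0 : ∀ r, 0 < r → 0 ≤ Q r)
    (hPM : ∀ᶠ r in 𝓝[>] 0, P r ≤ M * (-Real.log r))
    (h1 : ∀ ε : ℝ, 0 < ε → ∀ᶠ r in 𝓝[>] 0, Q r ≤ P (r / K) + ε * (-Real.log (r / K)))
    (h2 : ∀ ε : ℝ, 0 < ε → ∀ᶠ r in 𝓝[>] 0, P r ≤ Q (r / K) + ε * (-Real.log (r / K))) :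
    limsup (fun r => Q r / (-Real.log r)) (𝓝[>] 0) = limsup (fun r => P r / (-Real.log r)) (𝓝[>] 0) ∧
    liminf (fun r => Q r / (-Real.log r)) (𝓝[>] 0) = liminf (fun r => P r / (-Real.log r)) (𝓝[>] 0) := by
  have hK0 : 0 < K := by linarith
  have ht : Tendsto (fun r : ℝ => -Real.log r) (𝓝[>] 0) atTop :=
    tendsto_neg_atBot_atTop.comp Real.tendsto_log_nhdsGT_zero
  have hLpos : ∀ᶠ r : ℝ in 𝓝[>] 0, 0 < -Real.log r := ht.eventually (eventually_gt_atTop 0)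
  have hPL : ∀ᶠ r in 𝓝[>] 0, P r / (-Real.log r) ≤ M + 1 := by
    filter_upwards [hPM, hLpos] with r h3 h4
    rw [div_le_iff₀ h4]; nlinarith
  have hQL : ∀ᶠ r in 𝓝[>] 0, Q r / (-Real.log r) ≤ M + 2 := by
    filter_upwards [norm_compare P Q hK hM hPM h1 1 one_pos,
      (scale_tendsto' hK0).eventually hPL] with r h3 h4
    linarith
  have hQM : ∀ᶠ r in 𝓝[>] 0, Q r ≤ (M + 2) * (-Real.log r) := by
    filter_upwards [hQL, hLpos] with r h3 h4
    rwa [div_le_iff₀ h4] at h3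
  have hP0' : ∀ᶠ r in 𝓝[>] 0, 0 ≤ P r / (-Real.log r) := by
    filter_upwards [self_mem_nhdsWithin, hLpos] with r h3 h4
    exact div_nonneg (hP0 r h3) h4.le
  have hQ0' : ∀ᶠ r in 𝓝[>] 0, 0 ≤ Q r / (-Real.log r) := by
    filter_upwards [self_mem_nhdsWithin, hLpos] with r h3 h4
    exact div_nonneg (hQ0 r h3) h4.le
  have hPL' : ∀ᶠ r in 𝓝[>] 0, P r / (-Real.log r) ≤ M + 2 := by
    filter_upwards [hPL] with r h3
    linarith
  obtain ⟨a1, a2⟩ := lim_compare (fun r => P r / (-Real.log r)) (fun r => Q r / (-Real.log r))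
    hK0 hP0' hPL' hQ0' hQL (norm_compare P Q hK hM hPM h1)
  obtain ⟨b1, b2⟩ := lim_compare (fun r => Q r / (-Real.log r)) (fun r => P r / (-Real.log r))
    hK0 hQ0' hQL hP0' hPL' (norm_compare Q P hK (by linarith) hQM h2)
  exact ⟨le_antisymm a1 b1, le_antisymm a2 b2⟩

lemma dyadic_core (b τ : ℝ → ℝ) {A C : ℝ} {d : ℕ} (hA : 1 ≤ A) (hC : 0 < C)
    (hbm : ∀ r r', 0 < r → r ≤ r' → b r ≤ b r') (hb0 : ∀ r, 0 < r → 0 < b r)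
    (hb1 : ∀ r, 0 < r → b r ≤ 1) (hbl : ∀ᶠ r in 𝓝[>] 0, C * r ^ d ≤ b r)
    (hτm : ∀ r r', 0 < r → r ≤ r' → τ r' ≤ τ r) (hτ1 : ∀ r, 0 < r → 1 ≤ τ r)
    (hup : ∀ θ : ℝ, 0 < θ → θ < 1 → ∀ᶠ i : ℕ in atTop,
      τ (A * (1 / 2) ^ i) * b ((1 / 2) ^ i) * θ ^ i ≤ 1)
    (hlo : ∀ θ : ℝ, 0 < θ → θ < 1 → ∀ᶠ i : ℕ in atTop,
      θ ^ i ≤ τ ((1 / 2) ^ i) * b (A * (1 / 2) ^ i)) :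
    limsup (fun r => Real.log (τ r) / (-Real.log r)) (𝓝[>] 0) =
      limsup (fun r => Real.log (b r) / Real.log r) (𝓝[>] 0) ∧
    liminf (fun r => Real.log (τ r) / (-Real.log r)) (𝓝[>] 0) =
      liminf (fun r => Real.log (b r) / Real.log r) (𝓝[>] 0) := by
  have hA0 : 0 < A := by linarith
  have hK : 1 ≤ 2 * A := by linarith
  have hK0 : 0 < 2 * A := by linarith
  have hre : (fun r => Real.log (b r) / Real.log r) =
      fun r => (-Real.log (b r)) / (-Real.log r) := by
    ext r; rw [neg_div_neg_eq]
  rw [hre]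
  have small : ∀ c : ℝ, 0 < c → ∀ᶠ r : ℝ in 𝓝[>] 0, r < c := fun c hc =>
    (eventually_lt_nhds hc).filter_mono nhdsWithin_le_nhds
  have ht : Tendsto (fun r : ℝ => -Real.log r) (𝓝[>] 0) atTop :=
    tendsto_neg_atBot_atTop.comp Real.tendsto_log_nhdsGT_zero
  have dy : ∀ (I : ℕ) (r : ℝ), 0 < r → r < (1 / 2) ^ I → ∃ i, I ≤ i ∧
      (1 / 2 : ℝ) ^ (i + 1) < r ∧ r ≤ (1 / 2) ^ i := by
    intro I r hr hrI
    obtain ⟨i, hi1, hi2⟩ := exists_nat_pow_near_of_lt_one hr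
      (hrI.le.trans (pow_le_one₀ (by norm_num) (by norm_num))) (by norm_num : (0:ℝ) < 1 / 2)
      (by norm_num)
    refine ⟨i, ?_, hi1, hi2⟩
    have h3 : (1 / 2 : ℝ) ^ (i + 1) < (1 / 2) ^ I := hi1.trans hrI
    have := (pow_lt_pow_iff_right_of_lt_one₀ (by norm_num) (by norm_num)).1 h3
    omega
  have hθ0 : ∀ ε : ℝ, 0 < (1 / 2 : ℝ) ^ ε := fun ε => Real.rpow_pos_of_pos (by norm_num) ε
  have hθ1 : ∀ ε : ℝ, 0 < ε → (1 / 2 : ℝ) ^ ε < 1 := fun ε hε =>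
    Real.rpow_lt_one (by norm_num) (by norm_num) hε
  have hlogθ : ∀ (ε : ℝ) (i : ℕ), Real.log (((1 / 2 : ℝ) ^ ε) ^ i) =
      ε * Real.log ((1 / 2) ^ i) := by
    intro ε i
    rw [Real.log_pow, Real.log_pow, Real.log_rpow (by norm_num)]; ring
  apply real_core (fun r => -Real.log (b r)) (fun r => Real.log (τ r)) hK
    (by positivity : (0:ℝ) ≤ d + 1)
  · intro r hr
    have := Real.log_nonpos (hb0 r hr).le (hb1 r hr)
    linarith
  · intro r hr
    exact Real.log_nonneg (hτ1 r hr)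
  · filter_upwards [hbl, self_mem_nhdsWithin, ht.eventually (eventually_ge_atTop (-Real.log C))]
      with r h1 h2 h3
    have h2 : (0:ℝ) < r := h2
    have := Real.log_le_log (by positivity) h1
    rw [Real.log_mul hC.ne' (by positivity), Real.log_pow] at this
    linarith
  · intro ε hε
    obtain ⟨I, hI⟩ := eventually_atTop.1 (hup _ (hθ0 ε) (hθ1 ε hε))
    filter_upwards [small (A * (1 / 2) ^ I) (by positivity), self_mem_nhdsWithin] with r h1 h2
    have h2 : (0:ℝ) < r := h2
    obtain ⟨i, hiI, hi1, hi2⟩ := dy I (r / A) (by positivity) (by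
      rw [div_lt_iff₀ hA0]; linarith)
    have h3 := hI (i + 1) (by omega)
    have hp : (0:ℝ) < (1 / 2) ^ (i + 1) := by positivity
    have e1 : A * (1 / 2) ^ (i + 1) ≤ r := by
      rw [lt_div_iff₀ hA0] at hi1; linarith
    have e2 : r / (2 * A) ≤ (1 / 2) ^ (i + 1) := by
      rw [pow_succ, div_mul_eq_div_div_swap]; linarith
    have hr0 : 0 < r / (2 * A) := by positivity
    have hq : 0 < A * (1 / 2) ^ (i + 1) := by positivity
    have g1 := Real.log_le_log (by linarith [hτ1 r h2]) (hτm _ _ hq e1)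
    have g2 := Real.log_le_log (hb0 _ hr0) (hbm _ _ hr0 e2)
    have g3 := Real.log_le_log hr0 e2
    have p1 : 0 < τ (A * (1 / 2) ^ (i + 1)) := by linarith [hτ1 _ hq]
    have p2 := hb0 _ hp
    have p3 : 0 < ((1 / 2 : ℝ) ^ ε) ^ (i + 1) := pow_pos (hθ0 ε) _
    have g4 := Real.log_nonpos (by positivity) h3
    rw [Real.log_mul (by positivity) p3.ne', Real.log_mul p1.ne' p2.ne', hlogθ] at g4
    have g5 := mul_le_mul_of_nonneg_left g3 hε.le
    linarith
  · intro ε hε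
    obtain ⟨I, hI⟩ := eventually_atTop.1 (hlo _ (hθ0 ε) (hθ1 ε hε))
    filter_upwards [small ((2 * A) * (1 / 2) ^ I) (by positivity), self_mem_nhdsWithin] with r h1 h2
    have h2 : (0:ℝ) < r := h2
    have hr0 : 0 < r / (2 * A) := by positivity
    obtain ⟨i, hiI, hi1, hi2⟩ := dy I (r / (2 * A)) (by positivity) (by
      rw [div_lt_iff₀ hK0]; linarith)
    have h3 := hI i hiI
    have hp : (0:ℝ) < (1 / 2) ^ i := by positivity
    have hq : 0 < A * (1 / 2) ^ i := by positivity
    have e1 : A * (1 / 2) ^ i ≤ r := by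
      rw [lt_div_iff₀ hK0, pow_succ] at hi1; linarith
    have p1 : 0 < τ ((1 / 2) ^ i) := by linarith [hτ1 _ hp]
    have p2 := hb0 _ hq
    have g1 := Real.log_le_log p1 (hτm _ _ hr0 hi2)
    have g2 := Real.log_le_log p2 (hbm _ _ hq e1)
    have g3 := Real.log_le_log hr0 hi2
    have g4 := Real.log_le_log (pow_pos (hθ0 ε) _) h3
    rw [Real.log_mul p1.ne' p2.ne', hlogθ] at g4
    have g5 := mul_le_mul_of_nonneg_left g3 hε.le
    linarith

lemma hit_le {X : Type*} [PseudoMetricSpace X] (T : X → X) (x : X) (r : ℝ) (n : ℕ) (hn : 1 ≤ n)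
    (h : dist (T^[n] x) x < r) : hitTime T x x r ≠ ⊤ ∧ (hitTime T x x r).toNat ≤ n := by
  have h1 : hitTime T x x r ≤ (n : ℕ∞) := sInf_le ⟨n, ⟨hn, h⟩, rfl⟩
  refine ⟨ne_top_of_le_ne_top (ENat.natCast_ne_top n) h1, ?_⟩
  exact ENat.toNat_le_of_le_natCast h1

lemma hit_spec {X : Type*} [PseudoMetricSpace X] (T : X → X) (x : X) (r : ℝ)
    (h : hitTime T x x r ≠ ⊤) : 1 ≤ (hitTime T x x r).toNat ∧
      dist (T^[(hitTime T x x r).toNat] x) x < r := by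
  have hne : ((fun m : ℕ => (m : ℕ∞)) '' {m : ℕ | 1 ≤ m ∧ dist (T^[m] x) x < r}).Nonempty := by
    by_contra hcon
    rw [Set.not_nonempty_iff_eq_empty] at hcon
    apply h
    unfold hitTime
    rw [hcon, sInf_empty]
  obtain ⟨m, hm, hmeq⟩ := csInf_mem hne
  have : hitTime T x x r = (m : ℕ∞) := hmeq.symm
  rw [this]
  simpa using hm

lemma exists_theta {θ : ℝ} (h1 : θ < 1) : ∃ j : ℕ, θ ≤ 1 - 1 / ((j : ℝ) + 2) := by
  obtain ⟨j, hj⟩ := exists_nat_one_div_lt (sub_pos.2 h1)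
  refine ⟨j, ?_⟩
  have : 1 / ((j : ℝ) + 2) ≤ 1 / ((j : ℝ) + 1) := by gcongr; norm_num
  linarith

lemma theta_bounds (j : ℕ) : (0:ℝ) < 1 - 1 / ((j : ℝ) + 2) ∧ 1 - 1 / ((j : ℝ) + 2) < 1 := by
  have h : 0 < 1 / ((j : ℝ) + 2) := by positivity
  have h2 : 1 / ((j : ℝ) + 2) < 1 := by
    rw [div_lt_one (by positivity)]
    have : (0:ℝ) ≤ j := Nat.cast_nonneg j
    linarith
  constructor <;> linarith

lemma slow_return {X : Type*} [MetricSpace X] (T : X → X) (x : X) (q : ℕ)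
    (h : ∀ᶠ n : ℕ in atTop, (1 / (n : ℝ)) ^ q ≤ dist (T^[n] x) x) :
    ∀ᶠ i : ℕ in atTop, ∀ n : ℕ, 1 ≤ n → dist (T^[n] x) x < (1 / 2) ^ i →
      1 ≤ (1 / 2) ^ i * (n : ℝ) ^ q := by
  obtain ⟨N, hN⟩ := eventually_atTop.1 h
  have hpos : ∀ n : ℕ, 1 ≤ n → 0 < dist (T^[n] x) x := by
    intro n hn
    rw [dist_pos]
    intro heq
    have hfix : T^[n * (N + 1)] x = x := by
      rw [Function.iterate_mul]
      exact Function.iterate_fixed heq _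
    have h1 := hN (n * (N + 1)) (by nlinarith)
    rw [hfix, dist_self] at h1
    have : (0:ℝ) < (1 / ((n * (N + 1) : ℕ) : ℝ)) ^ q := by
      have : 0 < n * (N + 1) := by positivity
      positivity
    linarith
  have hfin : ∀ᶠ i : ℕ in atTop, ∀ n ∈ Finset.range N, 1 ≤ n → (1 / 2 : ℝ) ^ i < dist (T^[n] x) x := by
    rw [Filter.eventually_all_finset]
    intro n _
    by_cases hn : 1 ≤ n
    · have := (tendsto_pow_atTop_nhds_zero_of_lt_one (by norm_num : (0:ℝ) ≤ 1 / 2)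
        (by norm_num)).eventually (gt_mem_nhds (hpos n hn))
      filter_upwards [this] with i hi _ using hi
    · exact Eventually.of_forall fun i h => absurd h hn
  filter_upwards [hfin] with i hi n hn hd
  have hNn : N ≤ n := by
    by_contra hcon
    have := hi n (Finset.mem_range.2 (not_le.1 hcon)) hn
    linarith
  have h1 := (hN n hNn).trans hd.le
  have hn0 : (0:ℝ) < n := by exact_mod_cast hn
  rwa [one_div_pow, div_le_iff₀ (by positivity)] at h1

/-- If `X ⊆ ℝ^d` and `(X,T,ν)` has decay of correlations for Lipschitz observables faster
than any polynomial rate, then for `ν`-a.e. `x` with `d̲_ν(x) > 0` the return time satisfies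
`limsup_{r→0} log τ_r(x)/(−log r) = d̄_ν(x)` and `liminf_{r→0} log τ_r(x)/(−log r) = d̲_ν(x)`. -/
theorem return_time_log_law
    (d : ℕ) (X : Set (EuclideanSpace ℝ (Fin d)))
    (T : EuclideanSpace ℝ (Fin d) → EuclideanSpace ℝ (Fin d)) (hTX : Set.MapsTo T X X)
    (ν : Measure (EuclideanSpace ℝ (Fin d))) [IsProbabilityMeasure ν] (hνX : ν X = 1)
    (hinv : MeasurePreserving T ν ν)
    (hdec : ∀ p : ℝ, 0 < p → ∃ Cp > (0 : ℝ),
      ∀ f g : EuclideanSpace ℝ (Fin d) → ℝ, ∀ Kf Lf Kg Lg : ℝ,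
      (∀ x ∈ X, |f x| ≤ Kf) → (∀ x ∈ X, ∀ y ∈ X, |f x - f y| ≤ Lf * dist x y) →
      (∀ x ∈ X, |g x| ≤ Kg) → (∀ x ∈ X, ∀ y ∈ X, |g x - g y| ≤ Lg * dist x y) →
      Measurable f → Measurable g →
      ∀ n : ℕ, 1 ≤ n →
        |(∫ x, f x * g (T^[n] x) ∂ν) - (∫ x, f x ∂ν) * ∫ x, g x ∂ν|
          ≤ Cp * (n : ℝ) ^ (-p) * (Kf + Lf) * (Kg + Lg)) :
    ∀ᵐ x ∂ν, 0 < dimLower ν x →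
      (∀ r : ℝ, 0 < r → hitTime T x x r ≠ ⊤) ∧
      Filter.limsup
          (fun r : ℝ => Real.log ((hitTime T x x r).toNat : ℝ) / (-Real.log r))
          (𝓝[>] 0) = dimUpper ν x ∧
      Filter.liminf
          (fun r : ℝ => Real.log ((hitTime T x x r).toNat : ℝ) / (-Real.log r))
          (𝓝[>] 0) = dimLower ν x := by
  have hcor : CorrBound ν T := fun p hp => corr_bound X T ν hinv hdec p hp
  have hF0 := ball_lower ν
  have hF1 : ∀ᵐ x ∂ν, ∀ j : ℕ, ∀ᶠ i : ℕ in atTop, ∃ n : ℕ, 1 ≤ n ∧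
      dist (T^[n] x) x < (d + 1) * (1 / 2) ^ i ∧
      n * (ν (ball x ((1 / 2) ^ i))).toReal * (1 - 1 / ((j : ℝ) + 2)) ^ i ≤ 1 :=
    ae_all_iff.2 fun j => return_upper ν T hinv (theta_bounds j).1 (theta_bounds j).2
  have hF2 := ae_all_iff.2 fun R : ℕ => ae_all_iff.2 fun l : ℕ => ae_all_iff.2 fun j : ℕ =>
    no_fast_return ν T hcor R l j
  have hF3 := ae_all_iff.2 fun R : ℕ => ae_all_iff.2 fun q : ℕ => ae_all_iff.2 fun j : ℕ =>
    return_lower ν T hcor R q (theta_bounds j).1 (theta_bounds j).2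
  filter_upwards [hF0, hF1, hF2, hF3] with x h0 h1 h2 h3 hdim
  obtain ⟨C, hC, hCb⟩ := h0
  set b : ℝ → ℝ := fun r => (ν (ball x r)).toReal with hb
  have hbm : ∀ r r', 0 < r → r ≤ r' → b r ≤ b r' := fun r r' _ hr =>
    ENNReal.toReal_mono (measure_ne_top _ _) (measure_mono (ball_subset_ball hr))
  have hb0 : ∀ r, 0 < r → 0 < b r := by
    intro r hr
    have hsm : ∀ᶠ t : ℝ in 𝓝[>] 0, t < r :=
      (eventually_lt_nhds hr).filter_mono nhdsWithin_le_nhds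
    obtain ⟨t, ht1, ht2, ht3⟩ := (hCb.and (hsm.and self_mem_nhdsWithin)).exists
    have ht3 : (0:ℝ) < t := ht3
    have : 0 < C * t ^ d := by positivity
    exact lt_of_lt_of_le (lt_of_lt_of_le this ht1) (hbm t r ht3 ht2.le)
  have hb1 : ∀ r, 0 < r → b r ≤ 1 := fun r _ => by
    have := ENNReal.toReal_mono ENNReal.one_ne_top (prob_le_one (μ := ν) (s := ball x r))
    simpa using this
  -- all return times are finite
  have hfin : ∀ r : ℝ, 0 < r → hitTime T x x r ≠ ⊤ := by
    intro r hr
    have hsm : ∀ᶠ i : ℕ in atTop, ((d:ℝ) + 1) * (1 / 2) ^ i < r := by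
      have ht : Tendsto (fun i : ℕ => ((d:ℝ) + 1) * (1 / 2) ^ i) atTop (𝓝 (((d:ℝ) + 1) * 0)) :=
        (tendsto_pow_atTop_nhds_zero_of_lt_one (by norm_num) (by norm_num)).const_mul _
      rw [mul_zero] at ht
      exact ht.eventually (gt_mem_nhds hr)
    obtain ⟨i, ⟨n, hn, hd, _⟩, hi⟩ := ((h1 0).and hsm).exists
    exact (hit_le T x r n hn (hd.trans hi)).1
  refine ⟨hfin, ?_⟩
  -- positive lower dimension
  obtain ⟨a, ha, hau⟩ : ∃ a : ℝ, 0 < a ∧ ∀ᶠ r in 𝓝[>] 0, a ≤ Real.log (b r) / Real.log r := by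
    by_contra hcon
    have : dimLower ν x ≤ 0 := by
      unfold dimLower
      rw [Filter.liminf_eq]
      apply Real.sSup_nonpos
      intro a ha
      by_contra hpos
      exact hcon ⟨a, not_le.1 hpos, ha⟩
    linarith
  obtain ⟨l, hl⟩ := exists_nat_one_div_lt ha
  have hG : ∃ j : ℕ, ∀ s : ℝ, 0 < s → s < 1 / (j + 1) → (ν (ball x s)).toReal ^ (l + 1) ≤ s := by
    have hsm : ∀ᶠ t : ℝ in 𝓝[>] 0, t < 1 :=
      (eventually_lt_nhds one_pos).filter_mono nhdsWithin_le_nhds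
    obtain ⟨δ, hδ, hδs⟩ := mem_nhdsGT_iff_exists_Ioo_subset.1 (hau.and hsm)
    have hδ : (0:ℝ) < δ := hδ
    obtain ⟨j, hj⟩ := exists_nat_one_div_lt hδ
    refine ⟨j, fun s hs hsj => ?_⟩
    obtain ⟨e1, e2⟩ := hδs ⟨hs, hsj.trans hj⟩
    have hlog : Real.log s < 0 := Real.log_neg hs e2
    have e3 : 1 / ((l : ℝ) + 1) ≤ Real.log (b s) / Real.log s := hl.le.trans e1
    rw [le_div_iff_of_neg hlog] at e3
    change b s ^ (l + 1) ≤ s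
    rw [← Real.log_le_log_iff (pow_pos (hb0 s hs) _) hs, Real.log_pow]
    push_cast
    rw [one_div_mul_eq_div, le_div_iff₀ (by positivity)] at e3
    linarith
  obtain ⟨j, hj⟩ := hG
  obtain ⟨R, hR⟩ := exists_nat_gt (dist x 0)
  have hslow := slow_return T x _ (h2 R l j hR hj)
  have hA : (1:ℝ) ≤ 3 * (d + 2) := by nlinarith [(Nat.cast_nonneg d : (0:ℝ) ≤ d)]
  have hτm : ∀ r r' : ℝ, 0 < r → r ≤ r' →
      ((hitTime T x x r').toNat : ℝ) ≤ ((hitTime T x x r).toNat : ℝ) := by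
    intro r r' hr hrr
    obtain ⟨e1, e2⟩ := hit_spec T x r (hfin r hr)
    exact_mod_cast (hit_le T x r' _ e1 (e2.trans_le hrr)).2
  refine dyadic_core b (fun r => ((hitTime T x x r).toNat : ℝ)) hA hC hbm hb0 hb1 hCb hτm ?_ ?_ ?_
  · intro r hr
    exact_mod_cast (hit_spec T x r (hfin r hr)).1
  · intro θ hθ0 hθ1
    obtain ⟨k, hk⟩ := exists_theta hθ1
    filter_upwards [h1 k] with i hi
    obtain ⟨n, hn, hd, hle⟩ := hi
    have hp : (0:ℝ) < (1 / 2) ^ i := by positivity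
    have e1 := (hit_le T x (3 * (d + 2) * (1 / 2) ^ i) n hn (hd.trans_le (by
      apply mul_le_mul_of_nonneg_right _ hp.le
      linarith [(Nat.cast_nonneg d : (0:ℝ) ≤ d)]))).2
    have e2 : ((hitTime T x x (3 * (d + 2) * (1 / 2) ^ i)).toNat : ℝ) ≤ n := by exact_mod_cast e1
    have e3 := (hb0 _ hp).le
    refine le_trans ?_ hle
    have e4 : θ ^ i ≤ (1 - 1 / ((k : ℝ) + 2)) ^ i := pow_le_pow_left₀ hθ0.le hk i
    exact mul_le_mul (mul_le_mul_of_nonneg_right e2 e3) e4 (by positivity) (by positivity)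
  · intro θ hθ0 hθ1
    obtain ⟨k, hk⟩ := exists_theta hθ1
    filter_upwards [h3 R (2 * (l + 1)) k hR, hslow] with i hi hsl
    have hp : (0:ℝ) < (1 / 2) ^ i := by positivity
    obtain ⟨e1, e2⟩ := hit_spec T x ((1 / 2) ^ i) (hfin _ hp)
    have e3 := hi _ e1 (hsl _ e1 e2) e2
    have e4 : θ ^ i ≤ (1 - 1 / ((k : ℝ) + 2)) ^ i := pow_le_pow_left₀ hθ0.le hk i
    exact e4.trans e3.le
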